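/- If a polynomial p ∈ ℂ[x,y] does not belong to any proper retract of ℂ[x,y], then p is a test polynomial, i.e., every ℂ-algebra endomorphism of ℂ[x,y] fixing p is an automorphism. -/

import Mathlib

open MvPolynomial

/-- `ℂ[x,y]` as multivariate polynomials in two variables. -/
local notation "P" => MvPolynomial (Fin 2) ℂ

/-- A test polynomial: every `ℂ`-algebra endomorphism fixing it is an automorphism. -/
def IsTestPolynomial (p : P) : Prop :=
  ∀ φ : P →ₐ[ℂ] P, φ p = p → Function.Bijective φ

/-- A retract of `ℂ[x,y]`: the image of an idempotent `ℂ`-algebra endomorphism. -/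
def IsRetract (R : Subalgebra ℂ P) : Prop :=
  ∃ π : P →ₐ[ℂ] P, π.comp π = π ∧ π.range = R

/-- A proper retract: a retract different from `ℂ` and from `ℂ[x,y]`. -/
def IsProperRetract (R : Subalgebra ℂ P) : Prop :=
  IsRetract R ∧ R ≠ ⊥ ∧ R ≠ ⊤

/-- A derivation of a domain of characteristic zero kills every element algebraic over the base. -/
theorem Derivation.apply_eq_zero_of_isAlgebraic {R A : Type*} [CommRing R] [CommRing A] [IsDomain A]
    [CharZero A] [Algebra R A] [FaithfulSMul R A] (D : Derivation R A A) {x : A}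
    (hx : IsAlgebraic R x) : D x = 0 := by
  have hinj := FaithfulSMul.algebraMap_injective R A
  have := hinj.isDomain
  have : CharZero R := ⟨fun m n h => by simpa using congrArg (algebraMap R A) h⟩
  obtain ⟨q, hq, h0⟩ := hx
  induction hn : q.natDegree using Nat.strong_induction_on generalizing q with
  | _ n ih =>
    by_cases hd : q.natDegree = 0
    · rw [Polynomial.eq_C_of_natDegree_eq_zero hd] at hq h0
      rw [Polynomial.aeval_C, map_eq_zero_iff _ hinj] at h0
      simp [h0] at hq
    · have h1 := D.map_aeval q x
      rw [h0, map_zero, smul_eq_mul] at h1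
      rcases mul_eq_zero.mp h1.symm with h2 | h2
      · exact ih _ (hn ▸ Polynomial.natDegree_derivative_lt hd) _
          (fun h => hd (Polynomial.derivative_eq_zero.mp h)) h2 rfl
      · exact h2

/-- A derivation of a domain of characteristic zero that kills a subalgebra over which the domain
is algebraic is zero. -/
theorem Derivation.eq_zero_of_isAlgebraic {R A : Type*} [CommRing R] [CommRing A] [IsDomain A]
    [CharZero A] [Algebra R A] (D : Derivation R A A) (S : Subalgebra R A)
    [Algebra.IsAlgebraic S A] (hS : ∀ s ∈ S, D s = 0) : D = 0 := by
  let E : Derivation S A A := Derivation.mk'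
    { toFun := D
      map_add' := D.map_add
      map_smul' := fun s a => by
        rw [Subalgebra.smul_def, smul_eq_mul, D.leibniz, hS s s.2, smul_zero, add_zero]
        rfl }
    D.leibniz
  ext x
  exact E.apply_eq_zero_of_isAlgebraic (Algebra.IsAlgebraic.isAlgebraic x)

/-- `ℂ[x,y]` is algebraic over the subalgebra generated by two algebraically independent
polynomials. -/
theorem AlgebraicIndependent.isAlgebraic_adjoin_fin_two {v : Fin 2 → P}
    (hv : AlgebraicIndependent ℂ v) : Algebra.IsAlgebraic (Algebra.adjoin ℂ (Set.range v)) P :=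
  (hv.isTranscendenceBasis_of_trdeg_le_of_finite
    (by rw [MvPolynomial.trdeg_of_isDomain]; simp)).isAlgebraic

/-- The Jacobian derivation `J(f, ·)`. -/
noncomputable def jacobianDerivation (f : P) : Derivation ℂ P P :=
  pderiv 0 f • pderiv 1 - pderiv 1 f • pderiv 0

theorem jacobianDerivation_apply (f u : P) :
    jacobianDerivation f u = pderiv 0 f * pderiv 1 u - pderiv 1 f * pderiv 0 u := rfl

theorem jacobianDerivation_self (f : P) : jacobianDerivation f f = 0 := by
  rw [jacobianDerivation_apply]; ring

theorem totalDegree_pderiv_le (i : Fin 2) (u : P) : (pderiv i u).totalDegree ≤ u.totalDegree := by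
  conv_lhs => rw [u.as_sum, map_sum]
  refine totalDegree_finsetSum_le fun s hs => ?_
  rw [pderiv_monomial]
  refine (totalDegree_monomial_le _ _).trans (le_trans ?_ (le_totalDegree hs))
  rw [Finsupp.sum_fintype _ _ (by simp), Finsupp.sum_fintype _ _ (by simp)]
  exact Finset.sum_le_sum fun j _ => by simp

theorem totalDegree_jacobianDerivation_le (f u : P) :
    (jacobianDerivation f u).totalDegree ≤ f.totalDegree + u.totalDegree := by
  rw [jacobianDerivation_apply]
  refine (totalDegree_sub _ _).trans (max_le ?_ ?_) <;>
  exact (totalDegree_mul _ _).trans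
    (add_le_add (totalDegree_pderiv_le _ _) (totalDegree_pderiv_le _ _))

theorem jacobianDerivation_ne_zero {f g : P} (h : AlgebraicIndependent ℂ ![f, g]) :
    jacobianDerivation f g ≠ 0 := by
  intro hfg
  have := h.isAlgebraic_adjoin_fin_two
  have hD : jacobianDerivation f = 0 := by
    refine Derivation.eq_zero_of_isAlgebraic _ (Algebra.adjoin ℂ (Set.range ![f, g])) fun s hs => ?_
    refine Derivation.eqOn_adjoin (D2 := 0) ?_ hs
    rintro _ ⟨i, rfl⟩
    fin_cases i
    · exact jacobianDerivation_self f
    · exact hfg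
  have h0 : pderiv 0 f = 0 := by
    simpa [jacobianDerivation_apply] using DFunLike.congr_fun hD (X 1)
  have h1 : pderiv 1 f = 0 := by
    simpa [jacobianDerivation_apply] using DFunLike.congr_fun hD (X 0)
  refine h.transcendental 0 ?_
  have hc : f = C (coeff 0 f) := by
    ext s
    rw [coeff_C]
    split_ifs with hs
    · rw [hs]
    · have key : ∀ i : Fin 2, pderiv i f = 0 → s i ≠ 0 → coeff s f = 0 := fun i hi hsi => by
        have := coeff_pderiv (i := i) f (s - Finsupp.single i 1)
        rw [hi, coeff_zero, tsub_add_cancel_of_le (by simpa [Nat.one_le_iff_ne_zero] using hsi)]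
          at this
        simpa [Nat.cast_add_one_ne_zero] using this.symm
      by_contra hne
      refine hs (Eq.symm (Finsupp.ext fun i => ?_))
      by_contra hsi
      fin_cases i
      · exact hne (key 0 h0 hsi)
      · exact hne (key 1 h1 hsi)
  rw [Matrix.cons_val_zero, hc]
  exact isAlgebraic_algebraMap (A := P) _

theorem homogeneousComponent_mul_of_totalDegree_le {σ R : Type*} [CommSemiring R]
    {f g : MvPolynomial σ R} {a b : ℕ} (hf : f.totalDegree ≤ a) (hg : g.totalDegree ≤ b) :
    homogeneousComponent (a + b) (f * g) =
      homogeneousComponent a f * homogeneousComponent b g := by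
  classical
  have hz : ∀ {u : MvPolynomial σ R} {n : ℕ} {d : σ →₀ ℕ}, u.totalDegree ≤ n → n < d.degree →
      coeff d u = 0 := fun hu hd => by
    refine coeff_eq_zero_of_totalDegree_lt (lt_of_le_of_lt hu ?_)
    simpa [Finsupp.degree_apply] using hd
  ext d
  rw [coeff_homogeneousComponent, coeff_mul, coeff_mul]
  trans ∑ x ∈ Finset.HasAntidiagonal.antidiagonal d, if d.degree = a + b then coeff x.1 f * coeff x.2 g else 0
  · split_ifs <;> simp
  refine Finset.sum_congr rfl fun x hx => ?_
  have hd : d.degree = x.1.degree + x.2.degree := by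
    rw [← Finset.HasAntidiagonal.mem_antidiagonal.mp hx, map_add]
  rw [coeff_homogeneousComponent, coeff_homogeneousComponent]
  rcases lt_trichotomy x.1.degree a with h | h | h
  · rw [if_neg h.ne, zero_mul]
    split_ifs with hab
    · rw [hz (d := x.2) hg (by omega), mul_zero]
    · rfl
  · simp [hd, h]
  · rw [hz hf h]; simp

theorem homogeneousComponent_pow_of_totalDegree_le {σ R : Type*} [CommSemiring R]
    {f : MvPolynomial σ R} {a : ℕ} (hf : f.totalDegree ≤ a) (n : ℕ) :
    homogeneousComponent (a * n) (f ^ n) = homogeneousComponent a f ^ n := by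
  induction n with
  | zero => simp [homogeneousComponent_zero]
  | succ n ih =>
    rw [pow_succ, pow_succ, ← ih, mul_add_one, homogeneousComponent_mul_of_totalDegree_le _ hf]
    exact (totalDegree_pow _ _).trans (by rw [mul_comm]; gcongr)

/-- A nontrivial weighted homogeneous relation between `F` and `G`, where `G` has weight `r` times
that of `F`, forces `G` to be a scalar multiple of `F ^ r`. -/
theorem exists_eq_smul_pow_of_sum_eq_zero {K A : Type*} [Field K] [IsAlgClosed K] [CommRing A]
    [IsDomain A] [Algebra K A] {F G : A} (hF : F ≠ 0) {S : Finset (Fin 2 →₀ ℕ)} (hS : S.Nonempty)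
    {c : (Fin 2 →₀ ℕ) → K} (hc : ∀ s ∈ S, c s ≠ 0) {r I : ℕ} (hI : ∀ s ∈ S, s 0 + r * s 1 = I)
    (h0 : ∑ s ∈ S, c s • (F ^ s 0 * G ^ s 1) = 0) : ∃ γ : K, G = γ • F ^ r := by
  classical
  let L := FractionRing A
  have hinj : Function.Injective (algebraMap A L) := IsFractionRing.injective A L
  set φ := algebraMap A L
  have hφF : φ F ≠ 0 := by simpa [φ] using hF
  set z : L := φ G / φ F ^ r
  have hG : φ G = z * φ F ^ r := (div_mul_cancel₀ _ (pow_ne_zero _ hφF)).symm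
  let q : Polynomial K := ∑ s ∈ S, Polynomial.monomial (s 1) (c s)
  have hq : q ≠ 0 := by
    obtain ⟨s, hs⟩ := hS
    intro h
    have h1 : q.coeff (s 1) = c s := by
      simp only [q, Polynomial.finsetSum_coeff, Polynomial.coeff_monomial]
      rw [Finset.sum_eq_single s _ (fun h => absurd hs h), if_pos rfl]
      intro t ht hts
      refine if_neg fun h1 => hts (Finsupp.ext fun i => ?_)
      have := hI s hs
      have := hI t ht
      rw [h1] at this
      fin_cases i
      · simp only [Fin.zero_eta]; omega
      · exact h1
    rw [h, Polynomial.coeff_zero] at h1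
    exact hc s hs h1.symm
  have hz : Polynomial.aeval z q = 0 := by
    have h1 := congrArg φ h0
    have h2 : φ (∑ s ∈ S, c s • (F ^ s 0 * G ^ s 1)) = φ F ^ I * Polynomial.aeval z q := by
      simp only [q, map_sum, Finset.mul_sum, Polynomial.aeval_monomial]
      refine Finset.sum_congr rfl fun s hs => ?_
      rw [Algebra.smul_def, map_mul, map_mul, map_pow, map_pow, hG, ← hI s hs, mul_pow, pow_add,
        pow_mul, IsScalarTower.algebraMap_apply K A L]
      ring
    rw [h2, map_zero] at h1
    exact (mul_eq_zero.mp h1).resolve_left (pow_ne_zero _ hφF)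
  obtain ⟨γ, hγ⟩ : ∃ γ : K, algebraMap K L γ = z := by
    have hi : IsIntegral K z := isAlgebraic_iff_isIntegral.mp ⟨q, hq, hz⟩
    exact minpoly.mem_range_of_degree_eq_one K z
      (IsAlgClosed.degree_eq_one_of_irreducible K (minpoly.irreducible hi))
  refine ⟨γ, hinj ?_⟩
  rw [show φ G = z * φ F ^ r from hG, Algebra.smul_def, map_mul, map_pow, ← hγ,
    IsScalarTower.algebraMap_apply K A L]

/-- The polynomial obtained from `q` by applying the Euler operator `y ∂/∂y` `k` times, evaluated
at `(f, g)`. -/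
noncomputable def eulerEval (f g q : P) (k : ℕ) : P :=
  ∑ s ∈ q.support, ((s 1 : ℂ) ^ k * coeff s q) • (f ^ s 0 * g ^ s 1)

theorem eulerEval_zero (f g q : P) : eulerEval f g q 0 = aeval ![f, g] q := by
  rw [aeval_def, eval₂_eq']
  simp [eulerEval, Algebra.smul_def]

theorem jacobianDerivation_mul_eulerEval_succ (f g q : P) (k : ℕ) :
    jacobianDerivation f g * eulerEval f g q (k + 1) =
      g * jacobianDerivation f (eulerEval f g q k) := by
  simp only [eulerEval, map_sum, Finset.mul_sum]
  refine Finset.sum_congr rfl fun s _ => ?_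
  rw [Derivation.map_smul, Derivation.leibniz, Derivation.leibniz_pow, Derivation.leibniz_pow,
    jacobianDerivation_self]
  simp only [smul_eq_mul, nsmul_eq_mul, smul_eq_C_mul]
  rcases s 1 with _ | j
  · simp
  · simp only [map_mul, map_pow, map_natCast, add_tsub_cancel_right]
    ring

theorem totalDegree_eulerEval_le {f g : P} (hJ : jacobianDerivation f g ≠ 0) (q : P) (k : ℕ) :
    (eulerEval f g q k).totalDegree ≤
      (aeval ![f, g] q).totalDegree + k * (f.totalDegree + g.totalDegree) := by
  induction k with
  | zero => simp [eulerEval_zero]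
  | succ k ih =>
    by_cases hu : eulerEval f g q (k + 1) = 0
    · simp [hu]
    have h1 := totalDegree_mul_of_isDomain hJ hu
    rw [jacobianDerivation_mul_eulerEval_succ] at h1
    have h2 := totalDegree_mul g (jacobianDerivation f (eulerEval f g q k))
    have h3 := totalDegree_jacobianDerivation_le f (eulerEval f g q k)
    rw [add_mul, one_mul]
    omega

theorem homogeneousComponent_eulerEval {f g q : P} {n m w : ℕ} (hf : f.totalDegree ≤ n)
    (hg : g.totalDegree ≤ m) (hw : ∀ s ∈ q.support, n * s 0 + m * s 1 ≤ w) (k : ℕ) :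
    homogeneousComponent w (eulerEval f g q k) =
      ∑ s ∈ q.support with n * s 0 + m * s 1 = w, ((s 1 : ℂ) ^ k * coeff s q) •
        (homogeneousComponent n f ^ s 0 * homogeneousComponent m g ^ s 1) := by
  rw [eulerEval, map_sum, Finset.sum_filter]
  refine Finset.sum_congr rfl fun s hs => ?_
  have hfd : (f ^ s 0).totalDegree ≤ n * s 0 :=
    (totalDegree_pow _ _).trans (by rw [mul_comm]; gcongr)
  have hgd : (g ^ s 1).totalDegree ≤ m * s 1 :=
    (totalDegree_pow _ _).trans (by rw [mul_comm]; gcongr)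
  rw [map_smul]
  split_ifs with h
  · rw [← h, homogeneousComponent_mul_of_totalDegree_le hfd hgd,
      homogeneousComponent_pow_of_totalDegree_le hf, homogeneousComponent_pow_of_totalDegree_le hg]
  · rw [homogeneousComponent_eq_zero, smul_zero]
    have := hw s hs
    have := totalDegree_mul (f ^ s 0) (g ^ s 1)
    omega

theorem totalDegree_lt_of_homogeneousComponent_eq_zero {σ R : Type*} [CommSemiring R]
    {u : MvPolynomial σ R} {a : ℕ} (hu : u.totalDegree ≤ a) (ha : 0 < a)
    (h : homogeneousComponent a u = 0) : u.totalDegree < a := by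
  rw [totalDegree, Finset.sup_lt_iff ha]
  intro s hs
  refine lt_of_le_of_ne ((le_totalDegree hs).trans hu) fun hsa => ?_
  have := congrArg (coeff s) h
  rw [coeff_homogeneousComponent, if_pos (by rw [Finsupp.degree_apply]; exact hsa)] at this
  exact mem_support_iff.mp hs this

/-- Vandermonde: nonzero terms indexed by distinct natural numbers have a nonzero power moment. -/
theorem exists_sum_natCast_pow_smul_ne_zero {ι A : Type*} [CommRing A] [IsDomain A] [Algebra ℂ A]
    {S : Finset ι} (hS : S.Nonempty) {e : ι → ℕ} (he : Set.InjOn e S) {c : ι → ℂ} {v : ι → A}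
    (hc : ∀ s ∈ S, c s ≠ 0) (hv : ∀ s ∈ S, v s ≠ 0) :
    ∃ k < S.card, ∑ s ∈ S, ((e s : ℂ) ^ k * c s) • v s ≠ 0 := by
  by_contra! h
  have : CharZero A := charZero_of_injective_algebraMap (algebraMap ℂ A).injective
  obtain ⟨t, ht⟩ := hS
  let ε := S.equivFin
  have h0 := Matrix.eq_zero_of_forall_pow_sum_mul_pow_eq_zero
    (f := fun j => (e (ε.symm j) : A)) (v := fun j => c (ε.symm j) • v (ε.symm j))
    (fun i j hij => ε.symm.injective (Subtype.ext
      (he (ε.symm i).2 (ε.symm j).2 (Nat.cast_injective hij)))) (fun k => by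
      rw [ε.symm.sum_comp (fun s => c s • v s * (e s : A) ^ (k : ℕ)),
        S.sum_coe_sort (fun s => c s • v s * (e s : A) ^ (k : ℕ)), ← h k k.2]
      refine Finset.sum_congr rfl fun s _ => ?_
      simp only [Algebra.smul_def, map_mul, map_pow, map_natCast]
      ring)
  have h1 := congrFun h0 (ε ⟨t, ht⟩)
  simp only [Equiv.symm_apply_apply, Pi.zero_apply, smul_eq_zero] at h1
  exact h1.elim (hc t ht) (hv t ht)

theorem six_mul_add_le_of_not_dvd {n m : ℕ} (hn : 0 < n) (hnm : n ≤ m) (h : ¬ n ∣ m) :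
    6 * (n + m) ≤ 5 * (n / n.gcd m * m) := by
  obtain ⟨d, a, b, hd, hab, rfl, rfl⟩ := Nat.exists_coprime' (Nat.gcd_pos_of_pos_left m hn)
  have hg : (a * d).gcd (b * d) = d := by rw [Nat.gcd_mul_right, hab, one_mul]
  rw [hg, Nat.mul_div_cancel _ hd]
  have ha : 2 ≤ a := by
    by_contra! ha
    have : a ≠ 0 := by rintro rfl; simp at hn
    have : a = 1 := by omega
    subst this
    exact h (Dvd.intro_left b (by ring))
  have hb : a < b := by
    refine lt_of_le_of_ne (Nat.le_of_mul_le_mul_right hnm hd) ?_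
    rintro rfl
    exact h dvd_rfl
  have : 6 * (a + b) ≤ 5 * (a * b) := by
    obtain ⟨x, rfl⟩ := Nat.exists_eq_add_of_le ha
    obtain ⟨y, rfl⟩ := Nat.exists_eq_add_of_le (show 3 ≤ b by omega)
    nlinarith [Nat.zero_le (x * y)]
  nlinarith

/-- The number of solutions of `n i + m j = w` is at most `w / (n' m) + 1`, with
`n' = n / gcd n m`. -/
theorem card_mul_le_of_weight_eq {n m w : ℕ} (hn : 0 < n) (hm : 0 < m)
    {S : Finset (Fin 2 →₀ ℕ)} (hS : ∀ s ∈ S, n * s 0 + m * s 1 = w) {k : ℕ} (hk : k < S.card) :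
    k * (n / n.gcd m * m) ≤ w := by
  set a := n / n.gcd m
  have ha : 0 < a := Nat.div_gcd_pos_of_pos_left m hn
  have hcard : S.card ≤ w / m / a + 1 := by
    rw [← Finset.card_range (w / m / a + 1)]
    refine Finset.card_le_card_of_injOn (fun s => s 1 / a) (fun s hs => ?_) fun s hs t ht hst => ?_
    · have := hS s hs
      simp only [Finset.coe_range, Set.mem_Iio, Nat.lt_succ_iff]
      refine Nat.div_le_div_right ((Nat.le_div_iff_mul_le hm).mpr ?_)
      nlinarith
    · have h1 := hS s hs
      have h2 := hS t ht
      have hmod : s 1 ≡ t 1 [MOD a] := by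
        refine Nat.ModEq.cancel_left_div_gcd hn (c := m) ?_
        have h3 : (n * s 0 + m * s 1) ≡ (n * t 0 + m * t 1) [MOD n] := by rw [h1, h2]
        simpa [Nat.ModEq, Nat.add_mod] using h3
      have h4 : s 1 = t 1 := by
        rw [← Nat.div_add_mod (s 1) a, ← Nat.div_add_mod (t 1) a, hmod]
        simp only at hst
        rw [hst]
      refine Finsupp.ext fun i => ?_
      fin_cases i
      · rw [← h2, h4] at h1
        exact Nat.eq_of_mul_eq_mul_left hn (Nat.add_right_cancel h1)
      · exact h4
  calc k * (a * m) ≤ (w / m / a) * (a * m) := by gcongr; omega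
    _ = (w / m / a * a) * m := by ring
    _ ≤ w / m * m := by gcongr; exact Nat.div_mul_le_self _ _
    _ ≤ w := Nat.div_mul_le_self _ _

/-- A degree estimate: if the leading form of `g` is not a scalar multiple of a power of that of
`f`, a polynomial in `f` and `g` has degree at least a sixth of its weighted degree. -/
theorem weight_le_six_mul_totalDegree_aeval {f g : P} (hJ : jacobianDerivation f g ≠ 0)
    (hn : 0 < f.totalDegree) (hnm : f.totalDegree ≤ g.totalDegree)
    (hred : ∀ (γ : ℂ) (r : ℕ), g.totalDegree = f.totalDegree * r →
      homogeneousComponent g.totalDegree g ≠ γ • homogeneousComponent f.totalDegree f ^ r)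
    (q : P) {s : Fin 2 →₀ ℕ} (hs : s ∈ q.support) :
    f.totalDegree * s 0 + g.totalDegree * s 1 ≤ 6 * (aeval ![f, g] q).totalDegree := by
  set n := f.totalDegree with hn'
  set m := g.totalDegree with hm'
  have hm : 0 < m := hn.trans_le hnm
  obtain ⟨t, ht, hmax⟩ := q.support.exists_max_image (fun s => n * s 0 + m * s 1) ⟨s, hs⟩
  refine (hmax s hs).trans ?_
  set w := n * t 0 + m * t 1
  set F := homogeneousComponent n f
  set G := homogeneousComponent m g
  have hF : F ≠ 0 := fun h =>
    (totalDegree_lt_of_homogeneousComponent_eq_zero hn'.ge hn h).ne hn'.symm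
  have hG : G ≠ 0 := fun h =>
    (totalDegree_lt_of_homogeneousComponent_eq_zero hm'.ge hm h).ne hm'.symm
  let S := q.support.filter fun s => n * s 0 + m * s 1 = w
  have hSw : ∀ s ∈ S, n * s 0 + m * s 1 = w := fun s hs => (Finset.mem_filter.mp hs).2
  have hSc : ∀ s ∈ S, coeff s q ≠ 0 := fun s hs => mem_support_iff.mp (Finset.mem_filter.mp hs).1
  have hSne : S.Nonempty := ⟨t, Finset.mem_filter.mpr ⟨ht, rfl⟩⟩
  have hdeg : ∀ k, ∑ s ∈ S, ((s 1 : ℂ) ^ k * coeff s q) • (F ^ s 0 * G ^ s 1) ≠ 0 →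
      w ≤ (aeval ![f, g] q).totalDegree + k * (n + m) := fun k hk => by
    rw [← homogeneousComponent_eulerEval hn'.ge hm'.ge hmax] at hk
    refine le_trans ?_ (totalDegree_eulerEval_le hJ q k)
    by_contra! h
    exact hk (homogeneousComponent_eq_zero _ _ h)
  by_cases h0 : ∑ s ∈ S, ((s 1 : ℂ) ^ 0 * coeff s q) • (F ^ s 0 * G ^ s 1) = 0
  · have hndvd : ¬ n ∣ m := by
      rintro ⟨r, hr⟩
      obtain ⟨γ, hγ⟩ := exists_eq_smul_pow_of_sum_eq_zero hF hSne hSc (r := r) (I := t 0 + r * t 1)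
        (fun s hs => Nat.eq_of_mul_eq_mul_left hn (by
          have := hSw s hs
          simp only [w] at this
          rw [hr] at this
          linarith)) (by simpa using h0)
      exact hred γ r hr hγ
    obtain ⟨k, hk, hne⟩ := exists_sum_natCast_pow_smul_ne_zero hSne (e := fun s => s 1)
      (v := fun s => F ^ s 0 * G ^ s 1) (fun s hs u hu h => Finsupp.ext fun i => by
        have h1 := hSw s hs
        have h2 := hSw u hu
        simp only at h
        fin_cases i
        · rw [← h2, h] at h1
          exact Nat.eq_of_mul_eq_mul_left hn (Nat.add_right_cancel h1)
        · exact h) hSc (fun s _ => mul_ne_zero (pow_ne_zero _ hF) (pow_ne_zero _ hG))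
    have h1 := hdeg k hne
    have h2 := card_mul_le_of_weight_eq hn hm hSw hk
    have h3 := Nat.mul_le_mul_left k (six_mul_add_le_of_not_dvd hn hnm hndvd)
    nlinarith
  · have := hdeg 0 h0
    omega

theorem exists_isProperRetract_of_fixed {π : P →ₐ[ℂ] P} (hπ : π.comp π = π)
    (hinj : ¬ Function.Injective π) {p : P} (hp : p ∉ (⊥ : Subalgebra ℂ P)) (hfix : π p = p) :
    ∃ R : Subalgebra ℂ P, IsProperRetract R ∧ p ∈ R := by
  have hmem : p ∈ π.range := ⟨p, hfix⟩
  refine ⟨π.range, ⟨⟨π, hπ, rfl⟩, fun h => hp (h ▸ hmem), fun h => hinj fun a b hab => ?_⟩, hmem⟩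
  have hid : ∀ z, π z = z := fun z => by
    obtain ⟨u, rfl⟩ : z ∈ π.range := h ▸ Algebra.mem_top
    exact DFunLike.congr_fun hπ u
  rwa [hid, hid] at hab

/-- The retraction `x ↦ x, y ↦ 0`. -/
noncomputable def projX : P →ₐ[ℂ] P := aeval ![X 0, 0]

theorem projX_comp_projX : projX.comp projX = projX := by
  ext i
  fin_cases i <;> simp [projX]

theorem projX_X_one : projX (X 1) = 0 := by simp [projX]

theorem projX_eq_self {q : P} (hq : ∀ s ∈ q.support, s 1 = 0) : projX q = q := by
  rw [projX, aeval_def, eval₂_eq']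
  conv_rhs => rw [q.as_sum]
  refine Finset.sum_congr rfl fun s hs => ?_
  rw [monomial_eq, Finsupp.prod_fintype _ _ (by simp)]
  simp [hq s hs]

theorem exists_isProperRetract_of_support {α : P ≃ₐ[ℂ] P} {p : P}
    (hp : p ∉ (⊥ : Subalgebra ℂ P)) (hα : ∀ s ∈ (α.symm p).support, s 1 = 0) :
    ∃ R : Subalgebra ℂ P, IsProperRetract R ∧ p ∈ R := by
  refine exists_isProperRetract_of_fixed
    (π := (α : P →ₐ[ℂ] P).comp (projX.comp (α.symm : P →ₐ[ℂ] P))) ?_ (fun h => ?_) hp ?_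
  · refine AlgHom.ext fun z => ?_
    simpa using DFunLike.congr_fun projX_comp_projX (α.symm z)
  · have h1 : α (X 1) = 0 := h (by simp [projX_X_one])
    simp at h1
  · simp [projX_eq_self hα]

theorem X_zero_notMem_bot : (X 0 : P) ∉ (⊥ : Subalgebra ℂ P) := by
  rintro ⟨c, hc⟩
  have := congrArg totalDegree hc
  simp at this

theorem transcendental_of_notMem_bot {p : P} (hp : p ∉ (⊥ : Subalgebra ℂ P)) :
    Transcendental ℂ p := fun h => hp <| by
  obtain ⟨c, hc⟩ := minpoly.mem_range_of_degree_eq_one ℂ p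
    (IsAlgClosed.degree_eq_one_of_irreducible ℂ (minpoly.irreducible h.isIntegral))
  exact ⟨c, hc⟩

/-- In a monoid, an element with a repeated power has an idempotent power. -/
theorem exists_pow_mul_pow_eq_self {M : Type*} [Monoid M] {x : M} {a b : ℕ} (hab : a < b)
    (h : x ^ (a + 1) = x ^ (b + 1)) : ∃ n ≠ 0, x ^ n * x ^ n = x ^ n := by
  obtain ⟨d, rfl⟩ := Nat.exists_eq_add_of_lt hab
  have hk : ∀ k, x ^ (a + 1) = x ^ (a + 1 + k * (d + 1)) := fun k => by
    induction k with
    | zero => simp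
    | succ k ih =>
      rw [show a + 1 + (k + 1) * (d + 1) = a + 1 + k * (d + 1) + (d + 1) by ring,
        pow_add _ (a + 1 + k * (d + 1)), ← ih, ← pow_add, h]
      congr 1
      ring
  refine ⟨(a + 1) * (d + 1), by positivity, ?_⟩
  have h1 : (a + 1) * (d + 1) = (a + 1) * d + (a + 1) := by ring
  rw [← pow_add]
  nth_rw 3 [h1]
  rw [pow_add x ((a + 1) * d), hk (a + 1), ← pow_add]
  congr 1
  ring

theorem isAlgebraic_apply_of_not_injective {φ : P →ₐ[ℂ] P} {p : P} (hfix : φ p = p)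
    (hp : Transcendental ℂ p) (hinj : ¬ Function.Injective φ) (z : P) :
    IsAlgebraic (Algebra.adjoin ℂ {p}) (φ z) := by
  by_contra htr
  have hind : AlgebraicIndependent ℂ ![φ z, p] := by
    have h1 : AlgebraicIndependent ℂ (fun _ : Fin 1 => p) :=
      algebraicIndependent_unique_type_iff.mpr hp
    have h2 := (h1.option_iff_transcendental (φ z)).mpr (by rwa [Set.range_const])
    refine (algebraicIndependent_equiv' (finSuccEquiv 1) ?_).mpr h2
    ext1 i
    fin_cases i <;> rfl
  have hcomp : φ ∘ ![z, p] = ![φ z, p] := by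
    ext1 i; fin_cases i <;> simp [hfix]
  have hind' : AlgebraicIndependent ℂ ![z, p] := .of_comp φ (hcomp ▸ hind)
  have := hind'.isAlgebraic_adjoin_fin_two
  obtain ⟨q, hq, hq0⟩ : ∃ q, φ q = 0 ∧ q ≠ 0 := by
    simpa [injective_iff_map_eq_zero] using hinj
  obtain ⟨⟨r, hr⟩, hr0, hqr⟩ := (Algebra.IsAlgebraic.isAlgebraic (R :=
    Algebra.adjoin ℂ (Set.range ![z, p])) q).exists_nonzero_dvd (mem_nonZeroDivisors_of_ne_zero hq0)
  have hφr : φ r = 0 := by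
    obtain ⟨c, hc⟩ := hqr
    rw [show r = q * c from hc, map_mul, hq, zero_mul]
  rw [Algebra.adjoin_range_eq_range_aeval] at hr
  obtain ⟨w, rfl⟩ := hr
  have hw : w = 0 := hind (by
    rw [map_zero, ← hcomp, ← hφr]
    exact (DFunLike.congr_fun (comp_aeval (R := ℂ) (f := ![z, p]) φ) w).symm)
  exact hr0 (Subtype.ext (by simp [hw]))

theorem pow_apply_eq_self {φ : P →ₐ[ℂ] P} {p : P} (hfix : φ p = p) (n : ℕ) : (φ ^ n) p = p := by
  induction n with
  | zero => rfl
  | succ n ih => rw [pow_succ, AlgHom.mul_apply, hfix, ih]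

theorem finite_range_pow_apply {φ : P →ₐ[ℂ] P} {p a : P} (hfix : φ p = p)
    (ha : IsAlgebraic (Algebra.adjoin ℂ {p}) a) :
    (Set.range fun n : ℕ => (φ ^ n) a).Finite := by
  obtain ⟨q, hq, hqa⟩ := ha
  refine (Polynomial.rootSet_finite q P).subset ?_
  rintro _ ⟨n, rfl⟩
  have hA : ∀ s ∈ Algebra.adjoin ℂ {p}, (φ ^ n) s = s := fun s hs =>
    AlgHom.eqOn_adjoin_iff (φ := φ ^ n) (ψ := AlgHom.id ℂ P) |>.mpr
      (Set.eqOn_singleton.mpr (pow_apply_eq_self hfix n)) hs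
  rw [Polynomial.mem_rootSet]
  refine ⟨hq, ?_⟩
  have := congrArg (φ ^ n) hqa
  rw [map_zero, Polynomial.aeval_eq_sum_range, map_sum] at this
  rw [Polynomial.aeval_eq_sum_range, ← this]
  refine Finset.sum_congr rfl fun i _ => ?_
  rw [Subalgebra.smul_def, Subalgebra.smul_def, smul_eq_mul, smul_eq_mul, map_mul, map_pow,
    hA _ (q.coeff i).2]

theorem exists_isProperRetract_of_not_injective {φ : P →ₐ[ℂ] P} {p : P} (hfix : φ p = p)
    (hp : p ∉ (⊥ : Subalgebra ℂ P)) (hinj : ¬ Function.Injective φ) :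
    ∃ R : Subalgebra ℂ P, IsProperRetract R ∧ p ∈ R := by
  have hfin : ∀ i, (Set.range fun n : ℕ => (φ ^ n) (φ (X i))).Finite := fun i =>
    finite_range_pow_apply hfix
      (isAlgebraic_apply_of_not_injective hfix (transcendental_of_notMem_bot hp) hinj _)
  obtain ⟨a, b, hab, heq⟩ := Set.Finite.exists_lt_map_eq_of_forall_mem
    (t := {f : Fin 2 → P | ∀ i, f i ∈ Set.range fun n : ℕ => (φ ^ n) (φ (X i))})
    (f := fun (n : ℕ) (i : Fin 2) => (φ ^ n) (φ (X i)))
    (fun n i => ⟨n, rfl⟩) (Set.Finite.pi' hfin)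
  obtain ⟨N, hN, hidem⟩ := exists_pow_mul_pow_eq_self (x := φ) hab
    (algHom_ext fun i => congrFun heq i)
  refine exists_isProperRetract_of_fixed (π := φ ^ N) hidem (fun h => hinj ?_) hp
    (pow_apply_eq_self hfix N)
  obtain ⟨k, rfl⟩ := Nat.exists_eq_succ_of_ne_zero hN
  rw [Nat.succ_eq_add_one, pow_succ] at h
  exact Function.Injective.of_comp (f := φ ^ k) h

/-- The elementary automorphism `x ↦ x, y ↦ y + c x ^ r`. -/
noncomputable def shear (c : ℂ) (r : ℕ) : P ≃ₐ[ℂ] P :=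
  AlgEquiv.ofAlgHom (aeval ![X 0, X 1 + c • X 0 ^ r]) (aeval ![X 0, X 1 - c • X 0 ^ r])
    (by ext i; fin_cases i <;> simp) (by ext i; fin_cases i <;> simp)

theorem totalDegree_pos_of_injective {χ : P →ₐ[ℂ] P} (hχ : Function.Injective χ) (i : Fin 2) :
    0 < (χ (X i)).totalDegree := by
  rw [pos_iff_ne_zero, Ne, totalDegree_eq_zero_iff_eq_C]
  intro h
  have h1 : (X i : P) = C (coeff 0 (χ (X i))) := hχ (by
    conv_lhs => rw [h]
    exact (χ.commutes _).symm)
  simpa using congrArg totalDegree h1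

/-- Any injective endomorphism can be composed with an automorphism so that the leading form of
the image of `y` is not a scalar multiple of a power of that of the image of `x`. -/
theorem exists_algEquiv_reduced {χ : P →ₐ[ℂ] P} (hχ : Function.Injective χ) :
    ∃ α : P ≃ₐ[ℂ] P, (χ (α (X 0))).totalDegree ≤ (χ (α (X 1))).totalDegree ∧
      ∀ (γ : ℂ) (r : ℕ), (χ (α (X 1))).totalDegree = (χ (α (X 0))).totalDegree * r →
        homogeneousComponent (χ (α (X 1))).totalDegree (χ (α (X 1))) ≠
          γ • homogeneousComponent (χ (α (X 0))).totalDegree (χ (α (X 0))) ^ r := by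
  let S : (P ≃ₐ[ℂ] P) → ℕ := fun α =>
    (χ (α (X 0))).totalDegree + (χ (α (X 1))).totalDegree
  obtain ⟨α, hle, hmin⟩ : ∃ α, (χ (α (X 0))).totalDegree ≤ (χ (α (X 1))).totalDegree ∧
      ∀ β, S α ≤ S β := by
    have hmin := fun β => Function.argmin_le S β
    rcases le_total (χ (Function.argmin S (X 0))).totalDegree
      (χ (Function.argmin S (X 1))).totalDegree with h | h
    · exact ⟨_, h, hmin⟩
    · refine ⟨(renameEquiv ℂ (Equiv.swap 0 1)).trans (Function.argmin S), ?_, fun β => ?_⟩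
      · simpa using h
      · refine le_trans (le_of_eq ?_) (hmin β)
        simp [S, add_comm]
  refine ⟨α, hle, fun γ r hr heq => ?_⟩
  have h1 := hmin ((shear (-γ) r).trans α)
  have h2 := totalDegree_pos_of_injective (χ := χ.comp (α : P →ₐ[ℂ] P))
    (hχ.comp α.injective) 1
  simp only [AlgHom.coe_comp, Function.comp_apply] at h2
  set f := χ (α (X 0))
  set g := χ (α (X 1))
  have h3 : (γ • f ^ r).totalDegree ≤ g.totalDegree :=
    (totalDegree_smul_le _ _).trans ((totalDegree_pow _ _).trans (by rw [hr, mul_comm]))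
  have h4 : (g - γ • f ^ r).totalDegree < g.totalDegree := by
    refine totalDegree_lt_of_homogeneousComponent_eq_zero
      ((totalDegree_sub _ _).trans (max_le le_rfl h3)) h2 ?_
    rw [map_sub, map_smul, heq]
    conv_lhs => rw [hr]
    rw [homogeneousComponent_pow_of_totalDegree_le le_rfl, sub_self]
  have h5 : S ((shear (-γ) r).trans α) = f.totalDegree + (g - γ • f ^ r).totalDegree := by
    simp [S, shear, f, g, sub_eq_add_neg]
  rw [h5] at h1
  exact absurd h1 (not_le.mpr (Nat.add_lt_add_left h4 _))

theorem aeval_apply_X (ψ : P →ₐ[ℂ] P) : aeval ![ψ (X 0), ψ (X 1)] = ψ := by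
  ext i; fin_cases i <;> simp

theorem jacobianDerivation_ne_zero_of_injective {ψ : P →ₐ[ℂ] P} (hψ : Function.Injective ψ) :
    jacobianDerivation (ψ (X 0)) (ψ (X 1)) ≠ 0 :=
  jacobianDerivation_ne_zero (by
    rw [AlgebraicIndependent, aeval_apply_X]
    exact hψ)

/-- If `χ` is injective and fixes `p`, then either `p` lies in a proper retract or, up to an
automorphism of the source, the degree of `χ` is bounded in terms of the degree of `p`. -/
theorem exists_isProperRetract_or_totalDegree_le {χ : P →ₐ[ℂ] P} {p : P} (hfix : χ p = p)
    (hp : p ∉ (⊥ : Subalgebra ℂ P)) (hχ : Function.Injective χ) :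
    (∃ R : Subalgebra ℂ P, IsProperRetract R ∧ p ∈ R) ∨
      ∃ α : P ≃ₐ[ℂ] P, ∀ i, (χ (α (X i))).totalDegree ≤ 6 * p.totalDegree := by
  obtain ⟨α, hle, hred⟩ := exists_algEquiv_reduced hχ
  by_cases hα : ∀ s ∈ (α.symm p).support, s 1 = 0
  · exact .inl (exists_isProperRetract_of_support hp hα)
  push Not at hα
  obtain ⟨s, hs, hs1⟩ := hα
  let ψ : P →ₐ[ℂ] P := χ.comp (α : P →ₐ[ℂ] P)
  have hψ : Function.Injective ψ := hχ.comp α.injective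
  have h1 := weight_le_six_mul_totalDegree_aeval (jacobianDerivation_ne_zero_of_injective hψ)
    (totalDegree_pos_of_injective hψ 0) hle hred (α.symm p) hs
  have h2 : ψ (α.symm p) = p := by simp [ψ, hfix]
  rw [aeval_apply_X, h2] at h1
  have h3 : (χ (α (X 1))).totalDegree ≤ 6 * p.totalDegree :=
    (Nat.le_mul_of_pos_right _ (Nat.pos_of_ne_zero hs1)).trans ((Nat.le_add_left _ _).trans h1)
  refine .inr ⟨α, fun i => ?_⟩
  fin_cases i
  · exact hle.trans h3
  · exact h3

theorem surjective_of_totalDegree_le {φ : P →ₐ[ℂ] P} (hφ : Function.Injective φ) {N : ℕ}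
    (h : ∀ k : ℕ, ∃ α : P ≃ₐ[ℂ] P, ∀ i, ((φ ^ k) (α (X i))).totalDegree ≤ N) :
    Function.Surjective φ := by
  let V : ℕ →o (Submodule ℂ (restrictTotalDegree (Fin 2) ℂ N))ᵒᵈ :=
    { toFun := fun k => OrderDual.toDual
        ((Subalgebra.toSubmodule (φ ^ k).range).comap (Submodule.subtype _))
      monotone' := monotone_nat_of_le_succ fun k => by
        refine OrderDual.toDual_le_toDual.mpr (Submodule.comap_mono ?_)
        rintro _ ⟨z, rfl⟩
        exact ⟨φ z, by rw [pow_succ]; rfl⟩ }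
  obtain ⟨k, hk⟩ := IsArtinian.monotone_stabilizes V
  obtain ⟨α, hα⟩ := h k
  have hmem : ∀ i, (φ ^ k) (α (X i)) ∈ (φ ^ (k + 1)).range := fun i => by
    have h1 : (⟨_, (mem_restrictTotalDegree _ _ _).mpr (hα i)⟩ :
        restrictTotalDegree (Fin 2) ℂ N) ∈ OrderDual.ofDual (V k) := ⟨_, rfl⟩
    rw [hk (k + 1) k.le_succ] at h1
    exact h1
  have hrange : ∀ z, (φ ^ k) (α z) ∈ (φ ^ (k + 1)).range := fun z => by
    induction z using MvPolynomial.induction_on with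
    | C c =>
      rw [C_eq_algebraMap, AlgEquiv.commutes, AlgHom.commutes]
      exact Subalgebra.algebraMap_mem _ c
    | add u v hu hv => simpa only [map_add] using add_mem hu hv
    | mul_X u i hu => simpa only [map_mul] using mul_mem hu (hmem i)
  have hinj : Function.Injective (φ ^ k) := by
    rw [AlgHom.coe_pow]
    exact hφ.iterate k
  intro z
  obtain ⟨w, hw⟩ := hrange (α.symm z)
  refine ⟨w, hinj ?_⟩
  rw [AlgEquiv.apply_symm_apply] at hw
  rw [← hw, pow_succ]
  rfl

/-- If a polynomial `p ∈ ℂ[x,y]` does not belong to any proper retract of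
`ℂ[x,y]`, then `p` is a test polynomial: every `ℂ`-algebra endomorphism of
`ℂ[x,y]` fixing `p` is an automorphism. -/
theorem test_of_not_in_proper_retract (p : P)
    (h : ¬∃ R : Subalgebra ℂ P, IsProperRetract R ∧ p ∈ R) :
    IsTestPolynomial p := by
  intro φ hfix
  by_cases hp : p ∈ (⊥ : Subalgebra ℂ P)
  · obtain ⟨R, hR, -⟩ := exists_isProperRetract_of_support (α := AlgEquiv.refl) X_zero_notMem_bot
      (fun s hs => by
        have : s = Finsupp.single 0 1 := by simpa using support_monomial_subset hs
        simp [this])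
    exact absurd ⟨R, hR, (bot_le : ⊥ ≤ R) hp⟩ h
  have hinj : Function.Injective φ := by
    by_contra hinj
    exact h (exists_isProperRetract_of_not_injective hfix hp hinj)
  refine ⟨hinj, surjective_of_totalDegree_le hinj (N := 6 * p.totalDegree) fun k => ?_⟩
  refine (exists_isProperRetract_or_totalDegree_le (χ := φ ^ k) (pow_apply_eq_self hfix k) hp
    ?_).resolve_left h
  rw [AlgHom.coe_pow]
  exact hinj.iterate k
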